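/- Let X, Y ∈ ℤ* with X ~ Y, and let a, b, α, β ∈ ℤ. (1) If det(X) ≠ 0 then: (a) (a, X, b) ≈_{(+,+)} (α, Y, β) if and only if α = a + δ(X,Y) and β = b + δ(X⁻,Y⁻); (b) (a, X) ≈_{(+,-)} (α, Y) if and only if α = a + δ(X,Y); (c) (X, b) ≈_{(-,+)} (Y, β) if and only if β = b + δ(X⁻,Y⁻). (2) If det(X) = 0 then: (a) (a, X, b) ≈_{(+,+)} (α, Y, β) if and only if α + β = a + b + δ(X,Y); (b) for all i, j ∈ ℤ, (i, X) ≈_{(+,-)} (j, Y) and (X, i) ≈_{(-,+)} (Y, j). -/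

import Mathlib

/-- `Y` is a blowing-up of the finite integer sequence `X`. -/
inductive SeqBlowup : List ℤ → List ℤ → Prop
  | empty : SeqBlowup [] [-1]
  | left (x : ℤ) (l : List ℤ) : SeqBlowup (x :: l) (-1 :: (x - 1) :: l)
  | mid (A B : List ℤ) (a b : ℤ) :
      SeqBlowup (A ++ a :: b :: B) (A ++ (a - 1) :: -1 :: (b - 1) :: B)
  | right (l : List ℤ) (x : ℤ) : SeqBlowup (l ++ [x]) (l ++ [x - 1, -1])

/-- Two sequences are equivalent if one is obtained from the other by a finite
sequence of blowings-up and blowings-down. -/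
def SeqEquiv (X Y : List ℤ) : Prop := Relation.EqvGen SeqBlowup X Y

/-- The determinant of the matrix `-M(X)`, where `M(X)` is the intersection matrix of
the sequence `X` (diagonal `xᵢ`, `1` on the off-diagonals `|i-j| = 1`); `det(∅) = 1`. -/
def seqDet : List ℤ → ℤ
  | [] => 1
  | [x] => -x
  | x :: y :: l => -x * seqDet (y :: l) - seqDet l

/-- `det₁(x₁,…,xₙ) = det(x₂,…,xₙ)`, with `det₁(∅) = 0`. -/
def seqDet1 : List ℤ → ℤ
  | [] => 0
  | _ :: l => seqDet l

/-- The intersection form of the sequence `X`: the symmetric bilinear form on `ℝⁿ`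
(`n = length of X`) whose matrix has `xᵢ` on the diagonal and `1` in positions
`(i,j)` with `|i-j| = 1`, evaluated at `(v, v)`. -/
noncomputable def seqForm (X : List ℤ) (v : Fin X.length → ℝ) : ℝ :=
  ∑ i, ∑ j, v i * (if i = j then ((X.get i : ℤ) : ℝ)
    else if i.val + 1 = j.val ∨ j.val + 1 = i.val then 1 else 0) * v j

/-- `hodge(X)`: the maximal dimension of a linear subspace of `ℝⁿ` on which the
intersection form of `X` is nonnegative. -/
noncomputable def seqHodge (X : List ℤ) : ℕ :=
  sSup { k | ∃ W : Submodule ℝ (Fin X.length → ℝ),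
      Module.finrank ℝ W = k ∧ ∀ v ∈ W, 0 ≤ seqForm X v }

/-- A `(+,+)`-blowing-up: only the interior (subdivisional) blowings-up. -/
inductive BlowupPP : List ℤ → List ℤ → Prop
  | mid (A B : List ℤ) (a b : ℤ) :
      BlowupPP (A ++ a :: b :: B) (A ++ (a - 1) :: -1 :: (b - 1) :: B)

/-- A `(+,-)`-blowing-up: interior blowings-up, or blowing-up at the right end. -/
inductive BlowupPM : List ℤ → List ℤ → Prop
  | mid (A B : List ℤ) (a b : ℤ) :
      BlowupPM (A ++ a :: b :: B) (A ++ (a - 1) :: -1 :: (b - 1) :: B)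
  | right (l : List ℤ) (x : ℤ) : BlowupPM (l ++ [x]) (l ++ [x - 1, -1])

/-- A `(-,+)`-blowing-up: interior blowings-up, or blowing-up at the left end. -/
inductive BlowupMP : List ℤ → List ℤ → Prop
  | mid (A B : List ℤ) (a b : ℤ) :
      BlowupMP (A ++ a :: b :: B) (A ++ (a - 1) :: -1 :: (b - 1) :: B)
  | left (x : ℤ) (l : List ℤ) : BlowupMP (x :: l) (-1 :: (x - 1) :: l)

/-- `(+,+)`-equivalence. -/
def EquivPP : List ℤ → List ℤ → Prop := Relation.EqvGen BlowupPP
/-- `(+,-)`-equivalence. -/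
def EquivPM : List ℤ → List ℤ → Prop := Relation.EqvGen BlowupPM
/-- `(-,+)`-equivalence. -/
def EquivMP : List ℤ → List ℤ → Prop := Relation.EqvGen BlowupMP

/-- `det_*(x₁,…,xₙ) = det(x₂,…,x_{n-1})` for `n > 2`, `1` for `n = 2`, `0` for `n < 2`. -/
def seqDetStar : List ℤ → ℤ
  | [] => 0
  | [_] => 0
  | _ :: y :: l => seqDet ((y :: l).dropLast)

/-- The integer `δ(X,Y)`, defined for equivalent sequences `X`, `Y`:
`(det₁(X) - det₁(Y))/d` if `d = det(X) ≠ 0`, and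
`(-1)^(n-1) (det_*(X) - det_*(Y))` with `n = hodge(X)` if `d = 0`. -/
noncomputable def seqDelta (X Y : List ℤ) : ℤ :=
  if seqDet X ≠ 0 then (seqDet1 X - seqDet1 Y) / seqDet X
  else (-1 : ℤ) ^ (seqHodge X - 1) * (seqDetStar X - seqDetStar Y)

open Matrix

/-! ### Transfer matrices -/

/-- The `2 × 2` matrix attached to a single weight `x`. -/
def stepMatrix (x : ℤ) : Matrix (Fin 2) (Fin 2) ℤ := !![-x, -1; 1, 0]

/-- The product of the step matrices of a sequence; its entries are, up to sign, the
determinants of the sequence and of its truncations. -/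
def transferMatrix (L : List ℤ) : Matrix (Fin 2) (Fin 2) ℤ := (L.map stepMatrix).prod

@[simp] lemma transferMatrix_nil : transferMatrix [] = 1 := rfl

@[simp] lemma transferMatrix_cons (x : ℤ) (L : List ℤ) :
    transferMatrix (x :: L) = stepMatrix x * transferMatrix L := by
  simp [transferMatrix]

@[simp] lemma transferMatrix_append (K L : List ℤ) :
    transferMatrix (K ++ L) = transferMatrix K * transferMatrix L := by
  simp [transferMatrix]

lemma seqDet_cons (x : ℤ) (L : List ℤ) :
    seqDet (x :: L) = -x * seqDet L - seqDet1 L := by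
  cases L <;> simp [seqDet, seqDet1]

lemma transferMatrix_apply_zero_and_one_zero (L : List ℤ) :
    transferMatrix L 0 0 = seqDet L ∧ transferMatrix L 1 0 = seqDet1 L := by
  induction L with
  | nil => simp [seqDet, seqDet1]
  | cons x L ih =>
    rw [seqDet_cons]
    simp [stepMatrix, Matrix.mul_apply, Fin.sum_univ_two, ih, seqDet1]
    ring

lemma transferMatrix_apply_zero_zero (L : List ℤ) : transferMatrix L 0 0 = seqDet L :=
  (transferMatrix_apply_zero_and_one_zero L).1

lemma transferMatrix_apply_one_zero (L : List ℤ) : transferMatrix L 1 0 = seqDet1 L :=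
  (transferMatrix_apply_zero_and_one_zero L).2

lemma transferMatrix_reverse (L : List ℤ) :
    transferMatrix L.reverse =
      !![transferMatrix L 0 0, -transferMatrix L 1 0;
        -transferMatrix L 0 1, transferMatrix L 1 1] := by
  induction L with
  | nil => ext i j; fin_cases i <;> fin_cases j <;> simp
  | cons x L ih =>
    simp only [List.reverse_cons, transferMatrix_append, ih, transferMatrix_cons,
      transferMatrix_nil, mul_one]
    ext i j
    fin_cases i <;> fin_cases j <;>
      simp [stepMatrix, Matrix.mul_apply, Fin.sum_univ_two] <;> ring

lemma seqDet_reverse (L : List ℤ) : seqDet L.reverse = seqDet L := by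
  simp [← transferMatrix_apply_zero_zero, transferMatrix_reverse]

lemma transferMatrix_apply_zero_one (L : List ℤ) :
    transferMatrix L 0 1 = -seqDet1 L.reverse := by
  simp [← transferMatrix_apply_one_zero, transferMatrix_reverse]

lemma transferMatrix_apply_one_one {L : List ℤ} (hL : L ≠ []) :
    transferMatrix L 1 1 = -seqDetStar L := by
  rcases L with _ | ⟨x, _ | ⟨y, l⟩⟩
  · exact absurd rfl hL
  · simp [stepMatrix, seqDetStar]
  · have h := List.dropLast_append_getLast (List.cons_ne_nil y l)
    rw [seqDetStar, transferMatrix_cons, ← h, transferMatrix_append, List.dropLast_concat,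
      ← transferMatrix_apply_zero_zero]
    simp [stepMatrix, Matrix.mul_apply, Fin.sum_univ_two]

lemma det_transferMatrix (L : List ℤ) : (transferMatrix L).det = 1 := by
  induction L with
  | nil => simp
  | cons x L ih => rw [transferMatrix_cons, Matrix.det_mul, ih]; simp [stepMatrix]

lemma seqDet1_mul_seqDet1_reverse {L : List ℤ} (hL : seqDet L = 0) :
    seqDet1 L * seqDet1 L.reverse = 1 := by
  have h := det_transferMatrix L
  rw [Matrix.det_fin_two, transferMatrix_apply_zero_zero, hL, transferMatrix_apply_zero_one,
    transferMatrix_apply_one_zero] at h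
  linarith

/-! ### Basic properties of the equivalence relations -/

lemma EquivPP.trans {X Y Z : List ℤ} (h : EquivPP X Y) (h' : EquivPP Y Z) : EquivPP X Z :=
  Relation.EqvGen.trans _ _ _ h h'

lemma EquivPP.symm {X Y : List ℤ} (h : EquivPP X Y) : EquivPP Y X :=
  Relation.EqvGen.symm _ _ h

lemma EquivPM.trans {X Y Z : List ℤ} (h : EquivPM X Y) (h' : EquivPM Y Z) : EquivPM X Z :=
  Relation.EqvGen.trans _ _ _ h h'

lemma EquivPM.symm {X Y : List ℤ} (h : EquivPM X Y) : EquivPM Y X :=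
  Relation.EqvGen.symm _ _ h

lemma SeqEquiv.trans {X Y Z : List ℤ} (h : SeqEquiv X Y) (h' : SeqEquiv Y Z) : SeqEquiv X Z :=
  Relation.EqvGen.trans _ _ _ h h'

lemma SeqEquiv.symm {X Y : List ℤ} (h : SeqEquiv X Y) : SeqEquiv Y X :=
  Relation.EqvGen.symm _ _ h

lemma SeqEquiv.refl (X : List ℤ) : SeqEquiv X X := Relation.EqvGen.refl _

/-- A relation preserved by a map on generators is preserved on equivalence closures. -/
lemma Relation.EqvGen.map_of_rel {α β : Type*} {r : α → α → Prop} {s : β → β → Prop}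
    (f : α → β) (hf : ∀ x y, r x y → Relation.EqvGen s (f x) (f y)) {x y : α}
    (h : Relation.EqvGen r x y) : Relation.EqvGen s (f x) (f y) := by
  induction h with
  | rel x y h => exact hf x y h
  | refl x => exact .refl _
  | symm x y _ ih => exact ih.symm
  | trans x y z _ _ ih₁ ih₂ => exact ih₁.trans _ _ _ ih₂

lemma EquivPP.append (A B : List ℤ) {X Y : List ℤ} (h : EquivPP X Y) :
    EquivPP (A ++ X ++ B) (A ++ Y ++ B) := by
  refine Relation.EqvGen.map_of_rel (fun X => A ++ X ++ B) ?_ h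
  rintro _ _ ⟨K, L, a, b⟩
  refine .rel _ _ ?_
  simpa using BlowupPP.mid (A ++ K) (L ++ B) a b

lemma EquivPM.append_left (A : List ℤ) {X Y : List ℤ} (h : EquivPM X Y) :
    EquivPM (A ++ X) (A ++ Y) := by
  refine Relation.EqvGen.map_of_rel (fun X => A ++ X) ?_ h
  rintro _ _ (⟨K, L, a, b⟩ | ⟨l, x⟩)
  · exact .rel _ _ (by simpa using BlowupPM.mid (A ++ K) L a b)
  · exact .rel _ _ (by simpa using BlowupPM.right (A ++ l) x)

lemma EquivPP.equivPM {X Y : List ℤ} (h : EquivPP X Y) : EquivPM X Y :=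
  Relation.EqvGen.mono (fun _ _ ⟨K, L, a, b⟩ => .mid K L a b) _ _ h

lemma EquivPM.seqEquiv {X Y : List ℤ} (h : EquivPM X Y) : SeqEquiv X Y := by
  refine Relation.EqvGen.mono ?_ _ _ h
  rintro _ _ (⟨K, L, a, b⟩ | ⟨l, x⟩)
  · exact .mid K L a b
  · exact .right l x

lemma EquivPP.seqEquiv {X Y : List ℤ} (h : EquivPP X Y) : SeqEquiv X Y := h.equivPM.seqEquiv

lemma SeqEquiv.reverse {X Y : List ℤ} (h : SeqEquiv X Y) : SeqEquiv X.reverse Y.reverse := by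
  refine Relation.EqvGen.map_of_rel List.reverse ?_ h
  rintro _ _ (_ | ⟨x, l⟩ | ⟨K, L, a, b⟩ | ⟨l, x⟩)
  · exact .rel _ _ .empty
  · exact .rel _ _ (by simpa using SeqBlowup.right l.reverse x)
  · exact .rel _ _ (by simpa using SeqBlowup.mid L.reverse K.reverse b a)
  · exact .rel _ _ (by simpa using SeqBlowup.left x l.reverse)

lemma equivMP_iff_reverse {X Y : List ℤ} : EquivMP X Y ↔ EquivPM X.reverse Y.reverse := by
  constructor
  · refine fun h => Relation.EqvGen.map_of_rel List.reverse ?_ h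
    rintro _ _ (⟨K, L, a, b⟩ | ⟨x, l⟩)
    · exact .rel _ _ (by simpa using BlowupPM.mid L.reverse K.reverse b a)
    · exact .rel _ _ (by simpa using BlowupPM.right l.reverse x)
  · intro h
    have h' : EquivMP X.reverse.reverse Y.reverse.reverse := by
      refine Relation.EqvGen.map_of_rel List.reverse ?_ h
      rintro _ _ (⟨K, L, a, b⟩ | ⟨l, x⟩)
      · exact .rel _ _ (by simpa using BlowupMP.mid L.reverse K.reverse b a)
      · exact .rel _ _ (by simpa using BlowupMP.left x l.reverse)
    simpa using h'

lemma EquivPP.transferMatrix_eq {X Y : List ℤ} (h : EquivPP X Y) :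
    transferMatrix X = transferMatrix Y := by
  induction h with
  | rel X Y h =>
    obtain ⟨A, B, a, b⟩ := h
    simp only [transferMatrix_append, transferMatrix_cons, ← mul_assoc]
    congr 1
    simp only [mul_assoc]
    congr 1
    ext i j
    fin_cases i <;> fin_cases j <;>
      simp [stepMatrix, Matrix.mul_apply, Fin.sum_univ_two] <;> ring
  | refl => rfl
  | symm _ _ _ ih => exact ih.symm
  | trans _ _ _ _ _ ih₁ ih₂ => exact ih₁.trans ih₂

lemma EquivPM.seqDet_eq {X Y : List ℤ} (h : EquivPM X Y) : seqDet X = seqDet Y := by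
  induction h with
  | rel X Y h =>
    rcases h with ⟨A, B, a, b⟩ | ⟨l, x⟩
    · simp only [← transferMatrix_apply_zero_zero]
      rw [EquivPP.transferMatrix_eq (.rel _ _ (.mid A B a b))]
    · simp only [← transferMatrix_apply_zero_zero, transferMatrix_append]
      simp [stepMatrix, Matrix.mul_apply, Fin.sum_univ_two]
      ring
  | refl => rfl
  | symm _ _ _ ih => exact ih.symm
  | trans _ _ _ _ _ ih₁ ih₂ => exact ih₁.trans ih₂

/-- An equivalence `X ~ Y` extends to sequences with additional weights at the ends, which are
shifted by constants. -/
lemma SeqEquiv.exists_shift {X Y : List ℤ} (h : SeqEquiv X Y) :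
    ∃ s t : ℤ, (∀ a b, EquivPP (a :: (X ++ [b])) ((a + s) :: (Y ++ [b + t]))) ∧
      ∀ a, EquivPM (a :: X) ((a + s) :: Y) := by
  induction h with
  | rel X Y h =>
    rcases h with _ | ⟨x, l⟩ | ⟨A, B, a, b⟩ | ⟨l, x⟩
    · exact ⟨-1, -1, fun a b => .rel _ _ (.mid [] [] a b), fun a => .rel _ _ (.right [] a)⟩
    · exact ⟨-1, 0, fun a b => .rel _ _ (by simpa [← sub_eq_add_neg] using BlowupPP.mid [] (l ++ [b]) a x),
        fun a => .rel _ _ (.mid [] l a x)⟩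
    · exact ⟨0, 0, fun u v => .rel _ _ (by simpa using BlowupPP.mid (u :: A) (B ++ [v]) a b),
        fun u => .rel _ _ (by simpa using BlowupPM.mid (u :: A) B a b)⟩
    · exact ⟨0, -1, fun a b => .rel _ _ (by simpa [← sub_eq_add_neg] using BlowupPP.mid (a :: l) [] x b),
        fun a => .rel _ _ (by simpa using BlowupPM.right (a :: l) x)⟩
  | refl X => exact ⟨0, 0, fun a b => by simpa using .refl _, fun a => by simpa using .refl _⟩
  | symm X Y _ ih =>
    obtain ⟨s, t, h₁, h₂⟩ := ih
    refine ⟨-s, -t, fun a b => ?_, fun a => ?_⟩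
    · simpa using (h₁ (a + -s) (b + -t)).symm
    · simpa using (h₂ (a + -s)).symm
  | trans X Y Z _ _ ih₁ ih₂ =>
    obtain ⟨s, t, h₁, h₂⟩ := ih₁
    obtain ⟨s', t', h₁', h₂'⟩ := ih₂
    refine ⟨s + s', t + t', fun a b => ?_, fun a => ?_⟩
    · simpa only [add_assoc] using (h₁ a b).trans (h₁' (a + s) (b + t))
    · simpa only [add_assoc] using (h₂ a).trans (h₂' (a + s))

/-- The entries of the transfer matrix of a sequence with additional weights at both ends. -/
lemma transferMatrix_cons_concat (a b : ℤ) (X : List ℤ) :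
    transferMatrix (a :: (X ++ [b])) =
      !![(a * seqDet X + seqDet1 X) * b + a * seqDet1 X.reverse - transferMatrix X 1 1,
          a * seqDet X + seqDet1 X;
        -(b * seqDet X + seqDet1 X.reverse), -seqDet X] := by
  simp only [← transferMatrix_apply_zero_zero, ← transferMatrix_apply_one_zero]
  ext i j
  fin_cases i <;> fin_cases j <;>
    simp [stepMatrix, Matrix.mul_apply, Fin.sum_univ_two, transferMatrix_reverse] <;> ring

/-- The numerical invariants of `(+,+)`-equivalence. -/
lemma EquivPP.invariants {X Y : List ℤ} {a b c d : ℤ}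
    (h : EquivPP (a :: (X ++ [b])) (c :: (Y ++ [d]))) :
    seqDet X = seqDet Y ∧ a * seqDet X + seqDet1 X = c * seqDet Y + seqDet1 Y ∧
      b * seqDet X + seqDet1 X.reverse = d * seqDet Y + seqDet1 Y.reverse ∧
      (a * seqDet X + seqDet1 X) * b + a * seqDet1 X.reverse - transferMatrix X 1 1 =
        (c * seqDet Y + seqDet1 Y) * d + c * seqDet1 Y.reverse - transferMatrix Y 1 1 := by
  have h := h.transferMatrix_eq
  rw [transferMatrix_cons_concat, transferMatrix_cons_concat] at h
  have h00 := congrFun (congrFun h 0) 0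
  have h01 := congrFun (congrFun h 0) 1
  have h10 := congrFun (congrFun h 1) 0
  have h11 := congrFun (congrFun h 1) 1
  simp only [of_apply, cons_val', cons_val_zero, cons_val_one, cons_val_fin_one] at h00 h01 h10 h11
  exact ⟨by linarith, by linarith, by linarith, by linarith⟩

lemma SeqEquiv.seqDet_eq {X Y : List ℤ} (h : SeqEquiv X Y) : seqDet X = seqDet Y := by
  obtain ⟨s, t, h, -⟩ := h.exists_shift
  exact (h 0 0).invariants.1

/-! ### Reduction of sequences of determinant zero -/

/-- A family indexed by `ℤ` whose consecutive members are equivalent consists of equivalent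
elements. -/
lemma Relation.EqvGen.of_int_succ {α : Type*} {r : α → α → Prop} {f : ℤ → α}
    (h : ∀ n, Relation.EqvGen r (f n) (f (n + 1))) (m n : ℤ) :
    Relation.EqvGen r (f m) (f n) := by
  have key : ∀ n : ℤ, Relation.EqvGen r (f 0) (f n) := by
    intro n
    induction n using Int.induction_on with
    | zero => exact .refl _
    | succ i ih => exact ih.trans _ _ _ (h i)
    | pred i ih => exact ih.trans _ _ _ (by simpa using (h (-i - 1)).symm)
  exact (key m).symm.trans _ _ _ (key n)

/-- An interior zero allows weight to be transferred between its neighbours. -/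
lemma EquivPP.zero_shift (c m n : ℤ) : EquivPP [m, 0, c - m] [n, 0, c - n] := by
  refine Relation.EqvGen.of_int_succ (f := fun m => [m, 0, c - m]) (fun m => ?_) m n
  have h₁ : EquivPP [m, 0, c - m] [m, -1, -1, c - m - 1] :=
    .rel _ _ (by simpa using BlowupPP.mid [m] [] 0 (c - m))
  have h₂ : EquivPP [m + 1, 0, c - (m + 1)] [m, -1, -1, c - m - 1] :=
    .rel _ _ (by simpa [sub_sub] using BlowupPP.mid [] [c - (m + 1)] (m + 1) 0)
  exact h₁.trans h₂.symm

/-- A final zero allows its neighbour to be changed arbitrarily. -/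
lemma EquivPM.zero_shift (m n : ℤ) : EquivPM [m, 0] [n, 0] := by
  refine Relation.EqvGen.of_int_succ (f := fun m => [m, 0]) (fun m => ?_) m n
  have h₁ : EquivPM [m, 0] [m, -1, -1] := .rel _ _ (by simpa using BlowupPM.right [m] 0)
  have h₂ : EquivPM [m + 1, 0] [m, -1, -1] :=
    .rel _ _ (by simpa using BlowupPM.mid [] [] (m + 1) 0)
  exact h₁.trans h₂.symm

lemma SeqEquiv.zero_shift_left (m n : ℤ) (B : List ℤ) :
    SeqEquiv (0 :: m :: B) (0 :: n :: B) := by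
  simpa using ((EquivPM.zero_shift m n).append_left B.reverse).seqEquiv.reverse

lemma EquivPP.zero_zero_front (A B : List ℤ) :
    EquivPP (A ++ 0 :: 0 :: B) (0 :: 0 :: (A ++ B)) := by
  induction A with
  | nil => exact .refl _
  | cons x A ih =>
    have h₁ : EquivPP (x :: (A ++ 0 :: 0 :: B)) (x :: 0 :: 0 :: (A ++ B)) := by
      simpa using ih.append [x] []
    have h₂ : EquivPP (x :: 0 :: 0 :: (A ++ B)) (0 :: 0 :: x :: (A ++ B)) := by
      simpa using (EquivPP.zero_shift x x 0).append [] (A ++ B)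
    exact h₁.trans h₂

lemma SeqEquiv.zero_zero_cons {X Y : List ℤ} (h : SeqEquiv X Y) :
    SeqEquiv (0 :: 0 :: X) (0 :: 0 :: Y) := by
  refine Relation.EqvGen.map_of_rel (fun X => 0 :: 0 :: X) ?_ h
  rintro _ _ (_ | ⟨x, l⟩ | ⟨K, L, a, b⟩ | ⟨l, x⟩)
  · have h₁ : SeqEquiv [0, 0] [0, -1, -1] := .rel _ _ (by simpa using SeqBlowup.right [0] 0)
    exact h₁.trans (SeqEquiv.zero_shift_left _ _ _)
  · have h₁ : SeqEquiv (0 :: 0 :: x :: l) (0 :: -1 :: -1 :: (x - 1) :: l) :=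
      .rel _ _ (by simpa using SeqBlowup.mid [0] l 0 x)
    exact h₁.trans (SeqEquiv.zero_shift_left _ _ _)
  · exact .rel _ _ (.mid (0 :: 0 :: K) L a b)
  · exact .rel _ _ (.right (0 :: 0 :: l) x)

lemma SeqEquiv.zero_cons_cons (q : ℤ) (B : List ℤ) : SeqEquiv (0 :: q :: B) (0 :: 0 :: B) :=
  SeqEquiv.zero_shift_left q 0 B

lemma SeqEquiv.append_zero (A : List ℤ) (p : ℤ) : SeqEquiv (A ++ [p, 0]) (0 :: 0 :: A) := by
  have h₂ : SeqEquiv (A ++ [0, 0]) (0 :: 0 :: A) := by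
    simpa using (EquivPP.zero_zero_front A []).seqEquiv
  exact ((EquivPM.zero_shift p 0).append_left A).seqEquiv.trans h₂

lemma SeqEquiv.append_zero_cons (A B : List ℤ) (p q : ℤ) :
    SeqEquiv (A ++ p :: 0 :: q :: B) (0 :: 0 :: (A ++ (p + q) :: B)) := by
  have h₁ : EquivPP (A ++ p :: 0 :: q :: B) (A ++ 0 :: 0 :: (p + q) :: B) := by
    simpa using (EquivPP.zero_shift (p + q) p 0).append A B
  exact (h₁.trans (EquivPP.zero_zero_front A _)).seqEquiv

/-- The number of nonnegative weights of a sequence. -/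
def nonnegCount (X : List ℤ) : ℕ := X.countP (0 ≤ ·)

@[simp] lemma nonnegCount_nil : nonnegCount [] = 0 := rfl

@[simp] lemma nonnegCount_cons (x : ℤ) (X : List ℤ) :
    nonnegCount (x :: X) = nonnegCount X + if 0 ≤ x then 1 else 0 := by
  simp [nonnegCount, List.countP_cons]

@[simp] lemma nonnegCount_append (X Y : List ℤ) :
    nonnegCount (X ++ Y) = nonnegCount X + nonnegCount Y := by
  simp [nonnegCount]

lemma nonnegCount_eq_zero {X : List ℤ} : nonnegCount X = 0 ↔ ∀ x ∈ X, x < 0 := by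
  simp [nonnegCount, List.countP_eq_zero]

/-- A nonnegative weight can be removed, at the expense of splitting off a pair of zeros. -/
lemma exists_seqEquiv_of_nonneg (n : ℕ) (A B : List ℤ) :
    SeqEquiv (A ++ (n : ℤ) :: B) [0] ∨ ∃ X, SeqEquiv (A ++ (n : ℤ) :: B) (0 :: 0 :: X) ∧
      nonnegCount X ≤ nonnegCount A + nonnegCount B := by
  induction n generalizing A B with
  | zero =>
    rcases List.eq_nil_or_concat' A with rfl | ⟨A, p, rfl⟩ <;> rcases B with _ | ⟨q, B⟩
    · exact .inl (.refl _)
    · exact .inr ⟨B, .zero_cons_cons q B, by simp⟩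
    · exact .inr ⟨A, by simpa using SeqEquiv.append_zero A p, by simp⟩
    · refine .inr ⟨A ++ (p + q) :: B, by simpa using SeqEquiv.append_zero_cons A B p q, ?_⟩
      simp only [nonnegCount_append, nonnegCount_cons, nonnegCount_nil]
      split_ifs <;> omega
  | succ n ih =>
    rcases B with _ | ⟨q, B⟩
    · have h : SeqEquiv (A ++ [((n + 1 : ℕ) : ℤ)]) (A ++ [(n : ℤ), -1]) :=
        .rel _ _ (by simpa using SeqBlowup.right A (n + 1))
      rcases ih A [-1] with h' | ⟨X, h', hX⟩
      · exact .inl (h.trans h')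
      · exact .inr ⟨X, h.trans h', by simpa using hX⟩
    · have h : SeqEquiv (A ++ ((n + 1 : ℕ) : ℤ) :: q :: B) (A ++ (n : ℤ) :: -1 :: (q - 1) :: B) :=
        .rel _ _ (by simpa using SeqBlowup.mid A B (n + 1) q)
      rcases ih A (-1 :: (q - 1) :: B) with h' | ⟨X, h', hX⟩
      · exact .inl (h.trans h')
      · refine .inr ⟨X, h.trans h', hX.trans ?_⟩
        simp only [nonnegCount_cons]
        split_ifs <;> omega

/-- A sequence of negative weights containing `-1` can be shortened. -/
lemma exists_seqEquiv_of_neg {A B : List ℤ} (hA : ∀ x ∈ A, x ≤ -2) (hB : ∀ x ∈ B, x < 0) :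
    SeqEquiv (A ++ -1 :: B) [0] ∨ ∃ X, (SeqEquiv (A ++ -1 :: B) X ∨
      SeqEquiv (A ++ -1 :: B) (0 :: 0 :: X)) ∧ (∀ x ∈ X, x < 0) ∧
        X.length < (A ++ -1 :: B).length := by
  have hA' : ∀ x ∈ A, x < 0 := fun x hx => (hA x hx).trans_lt (by norm_num)
  rcases List.eq_nil_or_concat' A with rfl | ⟨A, p, rfl⟩ <;> rcases B with _ | ⟨q, B⟩
  · exact .inr ⟨[], .inl (.symm (.rel _ _ .empty)), by simp, by simp⟩
  · have h : SeqEquiv (-1 :: q :: B) ((q + 1) :: B) :=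
      .symm (.rel _ _ (by simpa using SeqBlowup.left (q + 1) B))
    by_cases hq : q = -1
    · subst hq
      rcases B with _ | ⟨r, B⟩
      · exact .inl h
      · refine .inr ⟨B, .inr (h.trans (.zero_cons_cons r B)), fun x hx => hB x (by simp [hx]), ?_⟩
        simp; omega
    · refine .inr ⟨(q + 1) :: B, .inl h, ?_, by simp⟩
      simp only [List.forall_mem_cons] at hB ⊢
      exact ⟨by omega, hB.2⟩
  · simp only [List.forall_mem_append, List.forall_mem_singleton] at hA hA'
    refine .inr ⟨A ++ [p + 1], .inl ?_, ?_, by simp⟩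
    · exact .symm (.rel _ _ (by simpa using SeqBlowup.right A (p + 1)))
    · simp only [List.forall_mem_append, List.forall_mem_singleton]
      exact ⟨hA'.1, by omega⟩
  · simp only [List.forall_mem_append, List.forall_mem_singleton, List.forall_mem_cons]
      at hA hA' hB
    have h : SeqEquiv (A ++ [p] ++ -1 :: q :: B) (A ++ (p + 1) :: (q + 1) :: B) :=
      .symm (.rel _ _ (by simpa using SeqBlowup.mid A B (p + 1) (q + 1)))
    by_cases hq : q = -1
    · subst hq
      rcases B with _ | ⟨r, B⟩
      · exact .inr ⟨A, .inr (h.trans (.append_zero A _)), hA'.1, by simp⟩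
      · refine .inr ⟨A ++ (p + 1 + r) :: B, .inr (h.trans (.append_zero_cons A B _ r)), ?_, ?_⟩
        · simp only [List.forall_mem_append, List.forall_mem_cons] at hB ⊢
          exact ⟨hA'.1, by omega, hB.2.2⟩
        · simp
    · refine .inr ⟨A ++ (p + 1) :: (q + 1) :: B, .inl h, ?_, by simp⟩
      simp only [List.forall_mem_append, List.forall_mem_cons]
      exact ⟨hA'.1, by omega, by omega, hB.2⟩

/-- A sequence of weights at most `-2` has positive determinant. -/
lemma seqDet1_lt_seqDet {X : List ℤ} (hX : ∀ x ∈ X, x ≤ -2) :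
    0 ≤ seqDet1 X ∧ seqDet1 X < seqDet X := by
  induction X with
  | nil => simp [seqDet, seqDet1]
  | cons x X ih =>
    simp only [List.forall_mem_cons] at hX
    obtain ⟨h₁, h₂⟩ := ih hX.2
    rw [seqDet_cons, seqDet1]
    exact ⟨by omega, by nlinarith [hX.1]⟩

/-- A list of integers less than `0` either has all its entries at most `-2`, or splits at its
first entry `-1`. -/
lemma forall_le_neg_two_or_exists_eq {X : List ℤ} (hX : ∀ x ∈ X, x < 0) :
    (∀ x ∈ X, x ≤ -2) ∨
      ∃ A B, X = A ++ -1 :: B ∧ (∀ x ∈ A, x ≤ -2) ∧ ∀ x ∈ B, x < 0 := by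
  induction X with
  | nil => simp
  | cons x X ih =>
    simp only [List.forall_mem_cons] at hX
    by_cases hx : x = -1
    · exact .inr ⟨[], X, by simp [hx], by simp, hX.2⟩
    · rcases ih hX.2 with h | ⟨A, B, rfl, hA, hB⟩
      · left
        simp only [List.forall_mem_cons]
        exact ⟨by omega, h⟩
      · refine .inr ⟨x :: A, B, rfl, ?_, hB⟩
        simp only [List.forall_mem_cons]
        exact ⟨by omega, hA⟩

lemma seqDet_zero_zero_cons (X : List ℤ) : seqDet (0 :: 0 :: X) = -seqDet X := by
  simp [seqDet_cons, seqDet1]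

/-- A sequence of determinant zero is equivalent to a sequence of zeros of odd length. -/
theorem exists_seqEquiv_replicate_zero (X : List ℤ) (hX : seqDet X = 0) :
    ∃ k : ℕ, SeqEquiv X (List.replicate (2 * k + 1) 0) := by
  have step : ∀ {X X' : List ℤ}, seqDet X = 0 → SeqEquiv X (0 :: 0 :: X') →
      (seqDet X' = 0 → ∃ k : ℕ, SeqEquiv X' (List.replicate (2 * k + 1) 0)) →
      ∃ k : ℕ, SeqEquiv X (List.replicate (2 * k + 1) 0) := by
    intro X X' hX h ih
    obtain ⟨k, hk⟩ := ih (by rw [← neg_eq_zero, ← seqDet_zero_zero_cons, ← h.seqDet_eq, hX])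
    exact ⟨k + 1, h.trans hk.zero_zero_cons⟩
  by_cases hneg : ∀ x ∈ X, x < 0
  · rcases forall_le_neg_two_or_exists_eq hneg with h | ⟨A, B, hAB, hA, hB⟩
    · have := seqDet1_lt_seqDet h
      omega
    · have hX0 := nonnegCount_eq_zero.2 hneg
      rcases exists_seqEquiv_of_neg hA hB with h | ⟨X', h, hX', hlt⟩
      · exact ⟨0, hAB ▸ h⟩
      · have hX0' := nonnegCount_eq_zero.2 hX'
        rw [← hAB] at h hlt
        rcases h with h | h
        · obtain ⟨k, hk⟩ := exists_seqEquiv_replicate_zero X' (h.seqDet_eq ▸ hX)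
          exact ⟨k, h.trans hk⟩
        · exact step hX h (exists_seqEquiv_replicate_zero X')
  · push Not at hneg
    obtain ⟨x, hx, hx0⟩ := hneg
    obtain ⟨A, B, hAB⟩ := List.append_of_mem hx
    lift x to ℕ using hx0
    rcases exists_seqEquiv_of_nonneg x A B with h | ⟨X', h, hlt⟩ <;> rw [← hAB] at h
    · exact ⟨0, h⟩
    · exact step hX h (exists_seqEquiv_replicate_zero X')
termination_by (nonnegCount X, X.length)
decreasing_by
  · exact Prod.lex_def.2 (.inr ⟨by rw [hX0, hX0'], hAB ▸ hlt⟩)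
  · exact Prod.lex_def.2 (.inr ⟨by rw [hX0, hX0'], hAB ▸ hlt⟩)
  · refine Prod.lex_def.2 (.inl ?_)
    simp only [hAB, nonnegCount_append, nonnegCount_cons, Nat.cast_nonneg, if_true]
    omega

lemma EquivPP.replicate_zero_shift (k : ℕ) (a b c : ℤ) :
    EquivPP (a :: (List.replicate (2 * k + 1) 0 ++ [b]))
      ((a + c) :: (List.replicate (2 * k + 1) 0 ++ [b - c])) := by
  induction k generalizing a b with
  | zero => simpa [add_sub_add_left_eq_sub] using EquivPP.zero_shift (a + b) a (a + c)
  | succ k ih =>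
    have h (u v : ℤ) := EquivPP.zero_zero_front [u] (List.replicate (2 * k + 1) 0 ++ [v])
    have h' := (ih a b).append [0, 0] []
    simp only [List.append_nil] at h'
    exact ((h a b).trans h').trans (h (a + c) (b - c)).symm

/-- For a sequence `X` of determinant zero, weight can be transferred between the two ends of
`(a, X, b)`. -/
lemma EquivPP.shift_of_seqDet_eq_zero {X : List ℤ} (hX : seqDet X = 0) (a b c : ℤ) :
    EquivPP (a :: (X ++ [b])) ((a + c) :: (X ++ [b - c])) := by
  obtain ⟨k, hk⟩ := exists_seqEquiv_replicate_zero X hX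
  obtain ⟨s, t, h, -⟩ := hk.exists_shift
  have h₁ := EquivPP.replicate_zero_shift k (a + s) (b + t) c
  have h₂ := h (a + c) (b - c)
  rw [show a + c + s = a + s + c by ring, show b - c + t = b + t - c by ring] at h₂
  exact ((h a b).trans h₁).trans h₂.symm

lemma EquivPM.replicate_zero_shift (k : ℕ) (m n : ℤ) :
    EquivPM (m :: List.replicate (2 * k + 1) 0) (n :: List.replicate (2 * k + 1) 0) := by
  induction k with
  | zero => exact EquivPM.zero_shift m n
  | succ k ih =>
    have h (u : ℤ) := (EquivPP.zero_zero_front [u] (List.replicate (2 * k + 1) 0)).equivPM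
    exact ((h m).trans (ih.append_left [0, 0])).trans (h n).symm

lemma EquivPM.of_seqDet_eq_zero {X Y : List ℤ} (h : SeqEquiv X Y) (hX : seqDet X = 0)
    (i j : ℤ) : EquivPM (i :: X) (j :: Y) := by
  obtain ⟨k, hk⟩ := exists_seqEquiv_replicate_zero X hX
  obtain ⟨s, -, -, h₁⟩ := hk.exists_shift
  obtain ⟨t, -, -, h₂⟩ := (h.symm.trans hk).exists_shift
  exact ((h₁ i).trans (EquivPM.replicate_zero_shift k _ _)).trans (h₂ j).symm

/-! ### The Hodge index of a sequence of determinant zero -/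

/-- The symmetric matrix of the intersection form of a sequence. -/
def intersectionMatrix (X : List ℤ) : Matrix (Fin X.length) (Fin X.length) ℝ :=
  Matrix.of fun i j => if i = j then ((X.get i : ℤ) : ℝ)
    else if i.val + 1 = j.val ∨ j.val + 1 = i.val then 1 else 0

lemma seqForm_eq_dotProduct (X : List ℤ) (v : Fin X.length → ℝ) :
    seqForm X v = v ⬝ᵥ (intersectionMatrix X *ᵥ v) := by
  simp only [seqForm, intersectionMatrix, dotProduct, mulVec, Matrix.of_apply, Finset.mul_sum,
    mul_assoc]

lemma intersectionMatrix_isSymm (X : List ℤ) : (intersectionMatrix X).IsSymm := by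
  refine Matrix.IsSymm.ext fun i j => ?_
  simp only [intersectionMatrix, Matrix.of_apply]
  by_cases h : i = j
  · subst h; rfl
  · simp [h, Ne.symm h, or_comm]

lemma intersectionMatrix_zero_zero (x : ℤ) (l : List ℤ) :
    intersectionMatrix (x :: l) (0 : Fin (l.length + 1)) (0 : Fin (l.length + 1)) = x := by
  simp [intersectionMatrix]

lemma intersectionMatrix_succ_succ (x : ℤ) (l : List ℤ) (i j : Fin l.length) :
    intersectionMatrix (x :: l) i.succ j.succ = intersectionMatrix l i j := by
  simp [intersectionMatrix]

lemma intersectionMatrix_zero_succ (x : ℤ) (l : List ℤ) (j : Fin l.length) :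
    intersectionMatrix (x :: l) (0 : Fin (l.length + 1)) j.succ =
      if j.val = 0 then 1 else 0 := by
  have : (0 : Fin (l.length + 1)) ≠ j.succ := (Fin.succ_ne_zero j).symm
  simp [intersectionMatrix, this, eq_comm]

lemma intersectionMatrix_succ_zero (x : ℤ) (l : List ℤ) (i : Fin l.length) :
    intersectionMatrix (x :: l) i.succ (0 : Fin (l.length + 1)) =
      if i.val = 0 then 1 else 0 := by
  rw [← intersectionMatrix_zero_succ x l i]
  exact (intersectionMatrix_isSymm (x :: l)).apply _ _

lemma det_neg_intersectionMatrix : ∀ X : List ℤ, (-intersectionMatrix X).det = seqDet X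
  | [] => by simp [seqDet]
  | [x] => by
    rw [Matrix.det_eq_elem_of_subsingleton _ (0 : Fin 1)]
    simp [intersectionMatrix, seqDet]
  | x :: y :: l => by
    have h₁ := det_neg_intersectionMatrix (y :: l)
    have h₂ := det_neg_intersectionMatrix l
    have e₁ : (-intersectionMatrix (x :: y :: l)).submatrix
        (Fin.succ : Fin (l.length + 1) → Fin (l.length + 2))
        ((0 : Fin (l.length + 2)).succAbove) = -intersectionMatrix (y :: l) := by
      ext i j
      simpa using intersectionMatrix_succ_succ x (y :: l) i j
    have e₂ : ((-intersectionMatrix (x :: y :: l)).submatrix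
        (Fin.succ : Fin (l.length + 1) → Fin (l.length + 2))
        ((1 : Fin (l.length + 2)).succAbove)).det = -(-intersectionMatrix l).det := by
      have e : ((-intersectionMatrix (x :: y :: l)).submatrix
          (Fin.succ : Fin (l.length + 1) → Fin (l.length + 2))
          ((1 : Fin (l.length + 2)).succAbove)).submatrix (0 : Fin (l.length + 1)).succAbove
          Fin.succ = -intersectionMatrix l := by
        ext i j
        have h := (intersectionMatrix_succ_succ x (y :: l) i.succ j.succ).trans
          (intersectionMatrix_succ_succ y l i j)
        simpa using h
      have hcol (i : Fin (l.length + 1)) := intersectionMatrix_succ_zero x (y :: l) i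
      rw [Matrix.det_succ_column_zero, Fin.sum_univ_succ, Finset.sum_eq_zero, e]
      · have h := hcol 0
        simp only [Fin.succ_zero_eq_one, Fin.val_zero, if_true] at h
        simp [h]
      · intro i _
        have h := hcol i.succ
        simp only [Fin.val_succ, Nat.succ_ne_zero, if_false] at h
        simp [h]
    have hrow (i : Fin (l.length + 1)) := intersectionMatrix_zero_succ x (y :: l) i
    have h := Matrix.det_succ_row_zero (n := l.length + 1) (-intersectionMatrix (x :: y :: l))
    rw [Fin.sum_univ_succ, Fin.sum_univ_succ, Finset.sum_eq_zero] at h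
    · refine h.trans ?_
      rw [e₁, Fin.succ_zero_eq_one, e₂, h₁, h₂, seqDet]
      have h00 := intersectionMatrix_zero_zero x (y :: l)
      have h01 := hrow 0
      simp only [Fin.succ_zero_eq_one, Fin.val_zero, if_true] at h01
      simp only [Matrix.neg_apply]
      erw [h00, h01]
      simp
      ring
    · intro i _
      have := hrow i.succ
      simp only [Fin.val_succ] at this
      rw [Matrix.neg_apply]
      erw [this]
      simp

/-- Real symmetric matrices can be diagonalized. -/
lemma Matrix.IsSymm.exists_diagonalization {ι : Type*} [Fintype ι] [DecidableEq ι]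
    {N : Matrix ι ι ℝ} (hN : N.IsSymm) :
    ∃ (V : Matrix ι ι ℝ) (c : ι → ℝ), (∀ u, V *ᵥ u = 0 → u = 0) ∧
      (∀ u, u ⬝ᵥ (N *ᵥ u) = ∑ i, c i * ((V *ᵥ u) i * (V *ᵥ u) i)) ∧ N.det = ∏ i, c i := by
  have hH : N.IsHermitian := by
    rw [Matrix.IsHermitian, Matrix.conjTranspose_eq_transpose_of_trivial]
    exact hN
  set U : Matrix ι ι ℝ := (hH.eigenvectorUnitary : Matrix ι ι ℝ)
  refine ⟨star U, hH.eigenvalues, fun u hu => ?_, fun u => ?_, hH.det_eq_prod_eigenvalues⟩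
  · have h : U * star U = 1 := Unitary.coe_mul_star_self hH.eigenvectorUnitary
    rw [← Matrix.one_mulVec u, ← h, ← Matrix.mulVec_mulVec, hu, Matrix.mulVec_zero]
  · have h := hH.spectral_theorem
    rw [Unitary.conjStarAlgAut_apply] at h
    have h' : N = U * diagonal hH.eigenvalues * star U := h
    have e : u ᵥ* U = star U *ᵥ u := by
      rw [Matrix.star_eq_conjTranspose, Matrix.conjTranspose_eq_transpose_of_trivial,
        Matrix.mulVec_transpose]
    calc u ⬝ᵥ (N *ᵥ u) = (u ᵥ* U) ⬝ᵥ (diagonal hH.eigenvalues *ᵥ (star U *ᵥ u)) := by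
          conv_lhs => rw [h']
          rw [← Matrix.dotProduct_mulVec, Matrix.mulVec_mulVec, Matrix.mulVec_mulVec,
            Matrix.mul_assoc]
      _ = _ := by
          rw [e]
          simp only [dotProduct, Matrix.mulVec_diagonal]
          exact Finset.sum_congr rfl fun i _ => by ring

/-- The Hodge index can be computed from a representation as a weighted sum of squares. -/
lemma seqHodge_add_ncard {X : List ℤ} (f : (Fin X.length → ℝ) ≃ₗ[ℝ] (Fin X.length → ℝ))
    (w : Fin X.length → ℝ) (hf : ∀ v, seqForm X v = ∑ i, w i * (f v i * f v i)) :
    seqHodge X + {i | w i < 0}.ncard = X.length := by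
  have hcompl : {i | 0 ≤ w i}.ncard + {i | w i < 0}.ncard = X.length := by
    have h := Set.ncard_add_ncard_compl {i | 0 ≤ w i}
    have e : {i | 0 ≤ w i}ᶜ = {i | w i < 0} := by ext; simp
    rw [e] at h
    simpa using h
  have hgr : IsGreatest { k | ∃ W : Submodule ℝ (Fin X.length → ℝ),
      Module.finrank ℝ W = k ∧ ∀ v ∈ W, 0 ≤ seqForm X v } {i | 0 ≤ w i}.ncard := by
    constructor
    · refine ⟨(Pi.spanSubset ℝ {i | 0 ≤ w i}).map f.symm.toLinearMap, ?_, ?_⟩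
      · exact (LinearEquiv.finrank_map_eq f.symm _).trans Pi.dim_spanSubset
      · rintro _ ⟨u, hu, rfl⟩
        rw [hf]
        refine Finset.sum_nonneg fun i _ => ?_
        by_cases hi : 0 ≤ w i
        · exact mul_nonneg hi (mul_self_nonneg _)
        · have : u i = 0 := Pi.mem_spanSubset_iff.1 hu i hi
          simp [this]
    · rintro _ ⟨W, rfl, hW⟩
      have h := QuadraticForm.sigPos_add_finrank_le_of_nonpos
        (Q := QuadraticMap.weightedSumSquares ℝ (-w)) (V := W.map f.toLinearMap) (by
          rintro _ ⟨v, hv, rfl⟩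
          have := hW v hv
          rw [hf] at this
          simpa [QuadraticMap.weightedSumSquares_apply] using this)
      rw [QuadraticForm.sigPos_weightedSumSquares] at h
      have e : Module.finrank ℝ (W.map f.toLinearMap) = Module.finrank ℝ W :=
        LinearEquiv.finrank_map_eq f W
      simp only [e, Pi.neg_apply, Left.neg_pos_iff, Module.finrank_fintype_fun_eq_card,
        Fintype.card_fin] at h
      omega
  rw [seqHodge, hgr.csSup_eq, hcompl]

lemma prod_neg_eq_neg_one_pow_mul {ι : Type*} [Fintype ι] (c : ι → ℝ) :
    ∏ i, -c i = (-1) ^ {i | 0 < c i}.ncard * ∏ i, |c i| := by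
  classical
  have h : ∀ i, -c i = (if 0 < c i then -1 else 1) * |c i| := by
    intro i
    split_ifs with h
    · rw [abs_of_pos h, neg_one_mul]
    · rw [abs_of_nonpos (not_lt.1 h), one_mul]
  rw [Finset.prod_congr rfl fun i _ => h i, Finset.prod_mul_distrib, Finset.prod_ite,
    Finset.prod_const, Finset.prod_const_one, mul_one, Set.ncard_eq_toFinset_card']
  simp

/-- A sequence with vanishing determinant has an isotropic vector with first coordinate `1`, in
the kernel of the intersection form. -/
lemma exists_mulVec_eq_zero_of_seqDet_eq_zero {x : ℤ} {l : List ℤ} (h : seqDet (x :: l) = 0)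
    (hl : seqDet l ≠ 0) :
    ∃ v : Fin (l.length + 1) → ℝ, intersectionMatrix (x :: l) *ᵥ v = 0 ∧ v 0 = 1 := by
  have hdet : (-intersectionMatrix (x :: l)).det = 0 := by
    rw [det_neg_intersectionMatrix, h, Int.cast_zero]
  obtain ⟨v, hv, hMv⟩ := Matrix.exists_mulVec_eq_zero_iff.2 hdet
  rw [Matrix.neg_mulVec, neg_eq_zero] at hMv
  change Fin (l.length + 1) → ℝ at v
  have hv0 : v 0 ≠ 0 := by
    intro hv0
    have htail : intersectionMatrix l *ᵥ Fin.tail v = 0 := by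
      ext i
      have := congrFun hMv i.succ
      simp only [mulVec, dotProduct] at this ⊢
      erw [Fin.sum_univ_succ] at this
      simpa [hv0, intersectionMatrix_succ_succ, Fin.tail] using this
    have hdet' : (-intersectionMatrix l).det ≠ 0 := by
      rw [det_neg_intersectionMatrix]
      exact_mod_cast hl
    have hz : Fin.tail v = 0 := by
      by_contra hne
      exact hdet' (Matrix.exists_mulVec_eq_zero_iff.1
        ⟨_, hne, by rw [Matrix.neg_mulVec, htail, neg_zero]⟩)
    apply hv
    ext i
    refine Fin.cases hv0 (fun j => congrFun hz j) i
  refine ⟨(v 0)⁻¹ • v, ?_, inv_mul_cancel₀ hv0⟩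
  erw [Matrix.mulVec_smul, hMv, smul_zero]

lemma seqForm_zero_cons (x : ℤ) (l : List ℤ) (u : Fin (l.length + 1) → ℝ) (hu : u 0 = 0) :
    seqForm (x :: l) u = seqForm l (Fin.tail u) := by
  rw [seqForm_eq_dotProduct, seqForm_eq_dotProduct]
  simp only [mulVec, dotProduct]
  erw [Fin.sum_univ_succ]
  rw [hu, zero_mul, zero_add]
  refine Finset.sum_congr rfl fun i _ => ?_
  erw [Fin.sum_univ_succ]
  rw [hu, mul_zero, zero_add]
  simp [intersectionMatrix_succ_succ, Fin.tail]

/-- The form is unchanged under translation by a vector of its kernel. -/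
lemma seqForm_sub_of_mulVec_eq_zero (X : List ℤ) (v k : Fin X.length → ℝ)
    (hk : intersectionMatrix X *ᵥ k = 0) : seqForm X (v - k) = seqForm X v := by
  rw [seqForm_eq_dotProduct, seqForm_eq_dotProduct, Matrix.mulVec_sub, hk, sub_zero,
    sub_dotProduct, Matrix.dotProduct_mulVec k, ← Matrix.mulVec_transpose,
    (intersectionMatrix_isSymm X).eq, hk, zero_dotProduct, sub_zero]

/-- For a sequence of determinant zero, the parity of the Hodge index is determined by `det₁`. -/
theorem neg_one_pow_seqHodge {X : List ℤ} (hX : seqDet X = 0) :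
    (-1 : ℤ) ^ (seqHodge X - 1) = seqDet1 X := by
  rcases X with _ | ⟨x, l⟩
  · simp [seqDet] at hX
  have hunit : seqDet l * seqDet1 (x :: l).reverse = 1 := seqDet1_mul_seqDet1_reverse hX
  have hl : seqDet l ≠ 0 := left_ne_zero_of_mul_eq_one hunit
  obtain ⟨k, hk, hk0⟩ := exists_mulVec_eq_zero_of_seqDet_eq_zero hX hl
  obtain ⟨V, c, hV, hform, hdet⟩ := (intersectionMatrix_isSymm l).exists_diagonalization
  let g : (Fin (l.length + 1) → ℝ) →ₗ[ℝ] (Fin (l.length + 1) → ℝ) :=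
    { toFun := fun v => Fin.cons (v 0) (V *ᵥ Fin.tail (v - v 0 • k))
      map_add' := fun u v => by
        have h : Fin.tail (u + v - (u + v) 0 • k) =
            Fin.tail (u - u 0 • k) + Fin.tail (v - v 0 • k) := by
          ext i
          simp only [Fin.tail, Pi.add_apply, Pi.sub_apply, Pi.smul_apply, smul_eq_mul]
          ring
        rw [h, Matrix.mulVec_add]
        ext i
        refine Fin.cases ?_ (fun j => ?_) i <;> simp
      map_smul' := fun r v => by
        have h : Fin.tail (r • v - (r • v) 0 • k) = r • Fin.tail (v - v 0 • k) := by
          ext i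
          simp only [Fin.tail, Pi.sub_apply, Pi.smul_apply, smul_eq_mul]
          ring
        rw [h, Matrix.mulVec_smul]
        ext i
        refine Fin.cases ?_ (fun j => ?_) i <;> simp }
  have hg : Function.Injective g := by
    rw [injective_iff_map_eq_zero]
    intro v hv
    have hv0 : v 0 = 0 := congrFun hv 0
    have hv1 : Fin.tail v = 0 := by
      refine hV _ (funext fun i => ?_)
      simpa [g, hv0] using congrFun hv i.succ
    ext i
    exact Fin.cases hv0 (fun j => congrFun hv1 j) i
  have hf (v : Fin (l.length + 1) → ℝ) : seqForm (x :: l) v =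
      ∑ i, (Fin.cons 0 c : Fin (l.length + 1) → ℝ) i * (g v i * g v i) := by
    have h₁ := seqForm_sub_of_mulVec_eq_zero (x :: l) v (v 0 • k)
      (by erw [Matrix.mulVec_smul, hk, smul_zero])
    rw [← h₁]
    erw [seqForm_zero_cons x l _ (by simp [hk0])]
    rw [seqForm_eq_dotProduct, hform, Fin.sum_univ_succ]
    simp [g]
  have hcount := seqHodge_add_ncard (X := x :: l) (LinearEquiv.ofInjectiveEndo g hg)
    (Fin.cons 0 c) hf
  have hprod : ∏ i, -c i = seqDet l := by
    rw [← det_neg_intersectionMatrix, Matrix.det_neg, hdet, Finset.prod_neg]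
    simp
  have habs : ∏ i, |c i| = 1 := by
    have h : |∏ i, -c i| = 1 := by
      rw [hprod, ← Int.cast_abs, Int.isUnit_iff_abs_eq.1 (IsUnit.of_mul_eq_one _ hunit),
        Int.cast_one]
    simpa [Finset.abs_prod] using h
  have hc (i : Fin l.length) : c i ≠ 0 := by
    intro hi
    rw [Finset.prod_eq_zero (Finset.mem_univ i) (by rw [hi, abs_zero])] at habs
    exact zero_ne_one habs
  have hneg : {i | (Fin.cons 0 c : Fin (l.length + 1) → ℝ) i < 0}.ncard =
      {i | c i < 0}.ncard := by
    rw [← Set.ncard_image_of_injective {i | c i < 0} (Fin.succ_injective _)]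
    congr 1
    ext i
    refine Fin.cases ?_ (fun j => ?_) i
    · simp
    · simp
  have hcompl : {i | 0 < c i}.ncard + {i | c i < 0}.ncard = l.length := by
    have h := Set.ncard_add_ncard_compl {i | 0 < c i}
    have e : {i | 0 < c i}ᶜ = {i | c i < 0} := by
      ext i
      simpa using (hc i).le_iff_lt
    rw [e] at h
    simpa using h
  have hhodge : seqHodge (x :: l) - 1 = {i | 0 < c i}.ncard := by
    erw [hneg] at hcount
    simp only [List.length_cons] at hcount
    omega
  have hreal : ((seqDet l : ℤ) : ℝ) = (-1) ^ {i | 0 < c i}.ncard := by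
    rw [← hprod, prod_neg_eq_neg_one_pow_mul, habs, mul_one]
  rw [hhodge, seqDet1]
  exact_mod_cast hreal.symm

/-! ### The criterion -/

lemma seqDelta_eq_of_seqDet_ne_zero {X Y : List ℤ} (hX : seqDet X ≠ 0) {s : ℤ}
    (hs : seqDet1 X = s * seqDet X + seqDet1 Y) : seqDelta X Y = s := by
  rw [seqDelta, if_pos hX, hs, add_sub_cancel_right, Int.mul_ediv_cancel _ hX]

lemma seqDelta_eq_of_seqDet_eq_zero {X Y : List ℤ} (hX : seqDet X = 0) (hY : seqDet Y = 0) :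
    seqDelta X Y = seqDet1 X * (transferMatrix Y 1 1 - transferMatrix X 1 1) := by
  have hne {Z : List ℤ} (hZ : seqDet Z = 0) : Z ≠ [] := by
    rintro rfl
    simp [seqDet] at hZ
  rw [seqDelta, if_neg (not_not.2 hX), neg_one_pow_seqHodge hX,
    transferMatrix_apply_one_one (hne hX), transferMatrix_apply_one_one (hne hY)]
  ring

lemma equivPM_cons_iff {X Y : List ℤ} (h : SeqEquiv X Y) (hX : seqDet X ≠ 0) (a α : ℤ) :
    EquivPM (a :: X) (α :: Y) ↔ α = a + seqDelta X Y := by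
  obtain ⟨s, t, h₁, h₂⟩ := h.exists_shift
  have hs := (h₁ 0 0).invariants.2.1
  rw [← h.seqDet_eq] at hs
  rw [seqDelta_eq_of_seqDet_ne_zero hX (s := s) (by linarith)]
  constructor
  · intro h'
    have e := (h₂ a).symm.trans h' |>.seqDet_eq
    rw [seqDet_cons, seqDet_cons, ← h.seqDet_eq] at e
    exact mul_right_cancel₀ hX (by linarith)
  · rintro rfl
    exact h₂ a

lemma equivPP_iff_of_seqDet_ne_zero {X Y : List ℤ} (h : SeqEquiv X Y) (hX : seqDet X ≠ 0)
    (a b α β : ℤ) :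
    EquivPP (a :: (X ++ [b])) (α :: (Y ++ [β])) ↔
      α = a + seqDelta X Y ∧ β = b + seqDelta X.reverse Y.reverse := by
  obtain ⟨s, t, h₁, -⟩ := h.exists_shift
  obtain ⟨hd, hs, ht, -⟩ := (h₁ 0 0).invariants
  rw [← hd] at hs ht
  rw [seqDelta_eq_of_seqDet_ne_zero hX (s := s) (by linarith),
    seqDelta_eq_of_seqDet_ne_zero (s := t) (by rwa [seqDet_reverse])
      (by rw [seqDet_reverse]; linarith)]
  constructor
  · intro h'
    obtain ⟨-, e₁, e₂, -⟩ := ((h₁ a b).symm.trans h').invariants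
    rw [← hd] at e₁ e₂
    exact ⟨mul_right_cancel₀ hX (by linarith), mul_right_cancel₀ hX (by linarith)⟩
  · rintro ⟨rfl, rfl⟩
    exact h₁ a b

lemma EquivPP.add_eq_of_seqDet_eq_zero {X Y : List ℤ} {a b α β : ℤ} (hX : seqDet X = 0)
    (h : EquivPP (a :: (X ++ [b])) (α :: (Y ++ [β]))) : α + β = a + b + seqDelta X Y := by
  obtain ⟨hd, h₁, h₂, h₃⟩ := h.invariants
  have hY : seqDet Y = 0 := hd ▸ hX
  have hu := seqDet1_mul_seqDet1_reverse hX
  have hsq : seqDet1 X * seqDet1 X = 1 := by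
    rcases Int.eq_one_or_neg_one_of_mul_eq_one hu with h | h <;> simp [h]
  have hrev : seqDet1 X.reverse = seqDet1 X := by
    linear_combination seqDet1 X * hu - seqDet1 X.reverse * hsq
  rw [seqDelta_eq_of_seqDet_eq_zero hX hY]
  simp only [hX, hY, mul_zero, zero_add] at h₁ h₂ h₃
  rw [← h₁, ← h₂, hrev] at h₃
  linear_combination (a + b - α - β) * hsq - seqDet1 X * h₃

lemma equivPP_iff_of_seqDet_eq_zero {X Y : List ℤ} (h : SeqEquiv X Y) (hX : seqDet X = 0)
    (a b α β : ℤ) :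
    EquivPP (a :: (X ++ [b])) (α :: (Y ++ [β])) ↔ α + β = a + b + seqDelta X Y := by
  refine ⟨EquivPP.add_eq_of_seqDet_eq_zero hX, fun e => ?_⟩
  obtain ⟨s, t, h₁, -⟩ := h.exists_shift
  have e' := (h₁ a b).add_eq_of_seqDet_eq_zero hX
  have h₂ := EquivPP.shift_of_seqDet_eq_zero (h.seqDet_eq ▸ hX) (a + s) (b + t) (α - (a + s))
  rw [show a + s + (α - (a + s)) = α by ring,
    show b + t - (α - (a + s)) = β by linarith] at h₂
  exact (h₁ a b).trans h₂

/-- **Proposition.** Let `X ~ Y` and `a, b, α, β ∈ ℤ`.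
(1) If `det(X) ≠ 0` then: (a) `(a,X,b) ≈₍₊,₊₎ (α,Y,β)` iff `α = a + δ(X,Y)` and
`β = b + δ(X⁻,Y⁻)`; (b) `(a,X) ≈₍₊,₋₎ (α,Y)` iff `α = a + δ(X,Y)`;
(c) `(X,b) ≈₍₋,₊₎ (Y,β)` iff `β = b + δ(X⁻,Y⁻)`.
(2) If `det(X) = 0` then: (a) `(a,X,b) ≈₍₊,₊₎ (α,Y,β)` iff
`α + β = a + b + δ(X,Y)`; (b) for all `i, j`, `(i,X) ≈₍₊,₋₎ (j,Y)` and
`(X,i) ≈₍₋,₊₎ (Y,j)`. -/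
theorem tau_equivalence_criterion (X Y : List ℤ) (h : SeqEquiv X Y)
    (a b α β : ℤ) :
    (seqDet X ≠ 0 →
      ((EquivPP (a :: (X ++ [b])) (α :: (Y ++ [β])) ↔
          (α = a + seqDelta X Y ∧ β = b + seqDelta X.reverse Y.reverse)) ∧
       (EquivPM (a :: X) (α :: Y) ↔ α = a + seqDelta X Y) ∧
       (EquivMP (X ++ [b]) (Y ++ [β]) ↔ β = b + seqDelta X.reverse Y.reverse))) ∧
    (seqDet X = 0 →
      ((EquivPP (a :: (X ++ [b])) (α :: (Y ++ [β])) ↔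
          α + β = a + b + seqDelta X Y) ∧
       (∀ i j : ℤ, EquivPM (i :: X) (j :: Y) ∧ EquivMP (X ++ [i]) (Y ++ [j])))) := by
  have hrev (X : List ℤ) (b : ℤ) : (X ++ [b]).reverse = b :: X.reverse := by simp
  refine ⟨fun hX => ⟨equivPP_iff_of_seqDet_ne_zero h hX a b α β, equivPM_cons_iff h hX a α, ?_⟩,
    fun hX => ⟨equivPP_iff_of_seqDet_eq_zero h hX a b α β,
      fun i j => ⟨EquivPM.of_seqDet_eq_zero h hX i j, ?_⟩⟩⟩
  · rw [equivMP_iff_reverse, hrev, hrev]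
    exact equivPM_cons_iff h.reverse (by rwa [seqDet_reverse]) b β
  · rw [equivMP_iff_reverse, hrev, hrev]
    exact EquivPM.of_seqDet_eq_zero h.reverse (by rwa [seqDet_reverse]) i j
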